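/- With r(i,j,k,n) counting colored quarter-plane walks as defined below, let R = Σ r(i,j,k,n) x^i y^j s^k z^n ∈ ℤ[[x,y,s,z]], and let R^y = Σ_{j,k,n} r(0,j,k,n) y^j s^k z^n, R^x = Σ_{i,k,n} r(i,0,k,n) x^i s^k z^n, R^0 = Σ_{k,n} r(0,0,k,n) s^k z^n, all viewed in ℤ[[x,y,s,z]]. Then: (1) the functional equation (xy − z(y+x²)(1+y))·R = xy − zy(1+y)·R^y + z(y² − x² + (s−1)y(x²+1))·R^x − zy(y+s−1)·R^0 holds in ℤ[[x,y,s,z]]; and (2) for all n, k ≥ 0, the number of Dyck paths P ∈ 𝒟_n with ds(P) = k equals Σ_i r(i,0,k,n). -/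

import Mathlib

/-- Steps of a colored quarter-plane walk: `E = (1,0)`, `W = (−1,0)`, `SE = (1,−1)`, and
two colors `NW1`, `NW2` of the step `NW = (−1,1)` (the second color is only allowed when
the step starts on the x-axis; elsewhere `NW` steps are "uncolored", i.e. of color `NW1`). -/
inductive QStep : Type
  | E | W | NW1 | NW2 | SE
  deriving DecidableEq

/-- The x-coordinate of the walk `w` after `j` steps. -/
def xpos (w : List QStep) (j : ℕ) : ℤ :=
  ((w.take j).count QStep.E : ℤ) + ((w.take j).count QStep.SE : ℤ)
    - ((w.take j).count QStep.W : ℤ) - ((w.take j).count QStep.NW1 : ℤ)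
    - ((w.take j).count QStep.NW2 : ℤ)

/-- The y-coordinate of the walk `w` after `j` steps. -/
def ypos (w : List QStep) (j : ℕ) : ℤ :=
  ((w.take j).count QStep.NW1 : ℤ) + ((w.take j).count QStep.NW2 : ℤ)
    - ((w.take j).count QStep.SE : ℤ)

/-- A colored quarter-plane walk: it starts at the origin, stays in the first quadrant, and
the second color `NW2` may only be used for `NW` steps starting at height `0`. -/
def IsColoredQWalk (w : List QStep) : Prop :=
  (∀ j, 0 ≤ xpos w j ∧ 0 ≤ ypos w j) ∧
    ∀ i < w.length, w.getD i QStep.E = QStep.NW2 → ypos w i = 0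

/-- The number of steps of `w` lying entirely on the x-axis, i.e. `E` or `W` steps taken at
a point with second coordinate `0`. -/
def axisSteps (w : List QStep) : ℕ :=
  ((Finset.range w.length).filter fun i =>
    (w.getD i QStep.SE = QStep.E ∨ w.getD i QStep.SE = QStep.W) ∧ ypos w i = 0).card

/-- `r i j k n`: the number of colored quarter-plane walks of length `n` ending at `(i,j)`
with exactly `k` steps lying entirely on the x-axis. -/
noncomputable def r (i j k n : ℕ) : ℕ :=
  {w : List QStep | IsColoredQWalk w ∧ w.length = n ∧
    xpos w n = i ∧ ypos w n = j ∧ axisSteps w = k}.ncard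

/-- `R = Σ r(i,j,k,n) x^i y^j s^k z^n ∈ ℤ[[x,y,s,z]]`.
Variables: `0 = x`, `1 = y`, `2 = s`, `3 = z`. -/
noncomputable def R : MvPowerSeries (Fin 4) ℤ := fun d =>
  (r (d 0) (d 1) (d 2) (d 3) : ℤ)

/-- `R^y = Σ_{j,k,n} r(0,j,k,n) y^j s^k z^n`, viewed in `ℤ[[x,y,s,z]]`. -/
noncomputable def Ry : MvPowerSeries (Fin 4) ℤ := fun d =>
  if d 0 = 0 then (r 0 (d 1) (d 2) (d 3) : ℤ) else 0

/-- `R^x = Σ_{i,k,n} r(i,0,k,n) x^i s^k z^n`, viewed in `ℤ[[x,y,s,z]]`. -/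
noncomputable def Rx : MvPowerSeries (Fin 4) ℤ := fun d =>
  if d 1 = 0 then (r (d 0) 0 (d 2) (d 3) : ℤ) else 0

/-- `R^0 = Σ_{k,n} r(0,0,k,n) s^k z^n`, viewed in `ℤ[[x,y,s,z]]`. -/
noncomputable def R0 : MvPowerSeries (Fin 4) ℤ := fun d =>
  if d 0 = 0 ∧ d 1 = 0 then (r 0 0 (d 2) (d 3) : ℤ) else 0

/-- The height of the lattice path encoded by `w` (with `true = U`, `false = D`) after `j` steps. -/
def ht (w : List Bool) (j : ℕ) : ℤ :=
  ((w.take j).count true : ℤ) - ((w.take j).count false : ℤ)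

/-- A Dyck path of semilength `n`: a grand Dyck path that never goes below the x-axis. -/
def IsDyck (n : ℕ) (w : List Bool) : Prop :=
  w.length = 2 * n ∧ w.count true = n ∧ ∀ j, 0 ≤ ht w j

/-- The degree of symmetry of a Dyck path of semilength `n`: the number of `i ∈ {1,…,n}`
such that `h_{i−1} = h_{2n+1−i}` and `h_i = h_{2n−i}`. -/
def dsGD (n : ℕ) (w : List Bool) : ℕ :=
  ((Finset.Icc 1 n).filter fun i =>
    ht w (i - 1) = ht w (2 * n + 1 - i) ∧ ht w i = ht w (2 * n - i)).card

instance : Fintype QStep :=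
  ⟨{QStep.E, QStep.W, QStep.NW1, QStep.NW2, QStep.SE}, fun s => by cases s <;> simp⟩

theorem sum_QStep (g : QStep → ℕ) :
    ∑ s, g s = g .E + g .W + g .NW1 + g .NW2 + g .SE := by
  have : (Finset.univ : Finset QStep) = {QStep.E, QStep.W, QStep.NW1, QStep.NW2, QStep.SE} := rfl
  rw [this]
  simp [add_assoc]

/-- Counting lists of length `n+1` by the last letter. -/
theorem ncard_snoc {α : Type} [Fintype α] (P : List α → Prop) (n : ℕ) :
    {w : List α | w.length = n + 1 ∧ P w}.ncard
      = ∑ s : α, {w : List α | w.length = n ∧ P (w ++ [s])}.ncard := by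
  classical
  have hf : ∀ s : α, {w : List α | w.length = n ∧ P (w ++ [s])}.Finite := fun s =>
    (List.finite_length_eq α n).subset fun w hw => hw.1
  have h1 : {w : List α | w.length = n + 1 ∧ P w}
      = ⋃ s : α, (fun w => w ++ [s]) '' {w : List α | w.length = n ∧ P (w ++ [s])} := by
    ext w
    simp only [Set.mem_ofPred_eq, Set.mem_iUnion, Set.mem_image]
    constructor
    · rintro ⟨hl, hP⟩
      rcases List.eq_nil_or_concat w with rfl | ⟨v, s, rfl⟩
      · simp at hl
      · rw [List.concat_eq_append] at *
        refine ⟨s, v, ⟨by simpa using hl, hP⟩, rfl⟩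
    · rintro ⟨s, v, ⟨hl, hP⟩, rfl⟩
      exact ⟨by simp [hl], hP⟩
  rw [h1, Set.ncard_iUnion_of_finite (fun s => (hf s).image _)]
  · rw [finsum_eq_sum_of_fintype]
    refine Finset.sum_congr rfl fun s _ => ?_
    exact Set.ncard_image_of_injective _ (fun a b h => by simpa using h)
  · intro s t hst
    rw [Function.onFun, Set.disjoint_left]
    rintro w ⟨a, _, rfl⟩ ⟨b, _, hb⟩
    have := List.append_inj' hb rfl
    simp at this
    exact hst this.2.symm

def dxs : QStep → ℤ
  | .E => 1 | .W => -1 | .NW1 => -1 | .NW2 => -1 | .SE => 1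
def dys : QStep → ℤ
  | .E => 0 | .W => 0 | .NW1 => 1 | .NW2 => 1 | .SE => -1

theorem xpos_snoc_le (w : List QStep) (s) (j : ℕ) (h : j ≤ w.length) :
    xpos (w ++ [s]) j = xpos w j := by
  simp [xpos, List.take_append_of_le_length h]
theorem ypos_snoc_le (w : List QStep) (s) (j : ℕ) (h : j ≤ w.length) :
    ypos (w ++ [s]) j = ypos w j := by
  simp [ypos, List.take_append_of_le_length h]
theorem xpos_snoc_gt (w : List QStep) (s) (j : ℕ) (h : w.length < j) :
    xpos (w ++ [s]) j = xpos w w.length + dxs s := by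
  unfold xpos
  rw [List.take_of_length_le (by simp; omega), List.take_of_length_le le_rfl]
  cases s <;> simp [List.count_append, dxs] <;> ring
theorem ypos_snoc_gt (w : List QStep) (s) (j : ℕ) (h : w.length < j) :
    ypos (w ++ [s]) j = ypos w w.length + dys s := by
  unfold ypos
  rw [List.take_of_length_le (by simp; omega), List.take_of_length_le le_rfl]
  cases s <;> simp [List.count_append, dys] <;> ring
theorem xpos_ge (w : List QStep) (j : ℕ) (h : w.length ≤ j) : xpos w j = xpos w w.length := by
  unfold xpos
  rw [List.take_of_length_le h, List.take_of_length_le le_rfl]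
theorem ypos_ge (w : List QStep) (j : ℕ) (h : w.length ≤ j) : ypos w j = ypos w w.length := by
  unfold ypos
  rw [List.take_of_length_le h, List.take_of_length_le le_rfl]

theorem walk_snoc (w : List QStep) (s : QStep) :
    IsColoredQWalk (w ++ [s]) ↔ IsColoredQWalk w ∧ 0 ≤ xpos w w.length + dxs s ∧
      0 ≤ ypos w w.length + dys s ∧ (s = QStep.NW2 → ypos w w.length = 0) := by
  unfold IsColoredQWalk
  constructor
  · rintro ⟨h1, h2⟩
    refine ⟨⟨fun j => ?_, fun i hi hs => ?_⟩, ?_, ?_, ?_⟩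
    · rcases le_total j w.length with h | h
      · have := h1 j
        rwa [xpos_snoc_le _ _ _ h, ypos_snoc_le _ _ _ h] at this
      · have := h1 w.length
        rwa [xpos_snoc_le _ _ _ le_rfl, ypos_snoc_le _ _ _ le_rfl, ← xpos_ge w j h,
          ← ypos_ge w j h] at this
    · have := h2 i (by simp; omega)
      rw [ypos_snoc_le _ _ _ hi.le, List.getD_append _ _ _ _ hi] at this
      exact this hs
    · have := (h1 (w.length + 1)).1
      rwa [xpos_snoc_gt _ _ _ (by omega)] at this
    · have := (h1 (w.length + 1)).2
      rwa [ypos_snoc_gt _ _ _ (by omega)] at this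
    · intro hs
      have := h2 w.length (by simp)
      rw [ypos_snoc_le _ _ _ le_rfl] at this
      exact this (by simp [hs])
  · rintro ⟨⟨h1, h2⟩, hx, hy, hs⟩
    refine ⟨fun j => ?_, fun i hi hsi => ?_⟩
    · rcases le_or_gt j w.length with h | h
      · rw [xpos_snoc_le _ _ _ h, ypos_snoc_le _ _ _ h]
        exact h1 j
      · rw [xpos_snoc_gt _ _ _ h, ypos_snoc_gt _ _ _ h]
        exact ⟨hx, hy⟩
    · have hi' : i ≤ w.length := by simp at hi; omega
      rw [ypos_snoc_le _ _ _ hi']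
      rcases hi'.lt_or_eq with h | h
      · rw [List.getD_append _ _ _ _ h] at hsi
        exact h2 i h hsi
      · subst h
        exact hs (by simpa using hsi)

theorem axis_snoc (w : List QStep) (s : QStep) :
    axisSteps (w ++ [s]) = axisSteps w +
      if (s = QStep.E ∨ s = QStep.W) ∧ ypos w w.length = 0 then 1 else 0 := by
  unfold axisSteps
  rw [List.length_append, List.length_singleton, Finset.range_add_one, Finset.filter_insert]
  have hc : ((Finset.range w.length).filter fun i =>
      ((w ++ [s]).getD i QStep.SE = QStep.E ∨ (w ++ [s]).getD i QStep.SE = QStep.W)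
        ∧ ypos (w ++ [s]) i = 0) = ((Finset.range w.length).filter fun i =>
    (w.getD i QStep.SE = QStep.E ∨ w.getD i QStep.SE = QStep.W) ∧ ypos w i = 0) := by
    refine Finset.filter_congr fun i hi => ?_
    have hi := Finset.mem_range.1 hi
    rw [ypos_snoc_le _ _ _ hi.le, List.getD_append _ _ _ _ hi]
  have hg : (w ++ [s]).getD w.length QStep.SE = s := by simp
  rw [hc, hg, ypos_snoc_le _ _ _ le_rfl]
  split_ifs with h
  · rw [Finset.card_insert_of_notMem (by simp)]
  · rfl

/-- `r` with integer arguments. -/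
noncomputable def rz (i j k : ℤ) (n : ℕ) : ℕ :=
  {w : List QStep | w.length = n ∧ (IsColoredQWalk w ∧
    xpos w n = i ∧ ypos w n = j ∧ (axisSteps w : ℤ) = k)}.ncard

theorem r_eq_rz (i j k n : ℕ) : r i j k n = rz i j k n := by
  unfold r rz
  congr 1
  ext w
  simp only [Set.mem_ofPred_eq, Nat.cast_inj]
  tauto

theorem rz_neg (i j k : ℤ) (n : ℕ) (h : i < 0 ∨ j < 0 ∨ k < 0) : rz i j k n = 0 := by
  unfold rz
  convert Set.ncard_empty (List QStep)
  ext w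
  simp only [Set.mem_ofPred_eq, Set.mem_empty_iff_false, iff_false]
  rintro ⟨-, hw, h1, h2, h3⟩
  have := hw.1 n
  omega

theorem rz_zero (i j k : ℤ) : rz i j k 0 = if i = 0 ∧ j = 0 ∧ k = 0 then 1 else 0 := by
  unfold rz
  have h0 : IsColoredQWalk [] := ⟨fun j => by simp [xpos, ypos], fun i hi => by simp at hi⟩
  split_ifs with h
  · obtain ⟨rfl, rfl, rfl⟩ := h
    rw [Set.ncard_eq_one]
    refine ⟨[], ?_⟩
    ext w
    simp only [Set.mem_ofPred_eq, List.length_eq_zero_iff, Set.mem_singleton_iff]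
    constructor
    · exact fun h => h.1
    · rintro rfl
      exact ⟨rfl, h0, by simp [xpos], by simp [ypos], by simp [axisSteps]⟩
  · convert Set.ncard_empty (List QStep)
    ext w
    simp only [Set.mem_ofPred_eq, Set.mem_empty_iff_false, iff_false, List.length_eq_zero_iff]
    rintro ⟨rfl, hw, h1, h2, h3⟩
    simp [xpos, ypos, axisSteps] at h1 h2 h3
    omega

theorem rz_succ (i j k : ℤ) (n : ℕ) (hi : 0 ≤ i) (hj : 0 ≤ j) :
    rz i j k (n + 1) =
      rz (i - 1) j (k - if j = 0 then 1 else 0) n + rz (i + 1) j (k - if j = 0 then 1 else 0) n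
      + rz (i + 1) (j - 1) k n + (if j = 1 then rz (i + 1) (j - 1) k n else 0)
      + rz (i - 1) (j + 1) k n := by
  unfold rz
  rw [ncard_snoc, sum_QStep]
  have key : ∀ s : QStep, ∀ w : List QStep, w.length = n →
      ((IsColoredQWalk (w ++ [s]) ∧ xpos (w ++ [s]) (n + 1) = i ∧ ypos (w ++ [s]) (n + 1) = j ∧
        (axisSteps (w ++ [s]) : ℤ) = k) ↔
      (IsColoredQWalk w ∧ xpos w n = i - dxs s ∧ ypos w n = j - dys s ∧
        (axisSteps w : ℤ) = k - (if (s = QStep.E ∨ s = QStep.W) ∧ j - dys s = 0 then 1 else 0) ∧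
        (s = QStep.NW2 → j - dys s = 0))) := by
    intro s w hw
    subst hw
    rw [walk_snoc, axis_snoc, xpos_snoc_gt _ _ _ (by omega), ypos_snoc_gt _ _ _ (by omega)]
    constructor
    · rintro ⟨⟨h1, h2, h3, h4⟩, h5, h6, h7⟩
      have e : ypos w w.length = j - dys s := by omega
      rw [e] at h4 h7
      refine ⟨h1, by omega, e, ?_, h4⟩
      push_cast at h7
      omega
    · rintro ⟨h1, h5, h6, h7, h4⟩
      rw [h6]
      refine ⟨⟨h1, by omega, by omega, h4⟩, by omega, by omega, ?_⟩
      push_cast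
      omega
  have key2 : ∀ s : QStep, {w : List QStep | w.length = n ∧ (IsColoredQWalk (w ++ [s]) ∧
      xpos (w ++ [s]) (n + 1) = i ∧ ypos (w ++ [s]) (n + 1) = j ∧
        (axisSteps (w ++ [s]) : ℤ) = k)} = {w : List QStep | w.length = n ∧
      (IsColoredQWalk w ∧ xpos w n = i - dxs s ∧ ypos w n = j - dys s ∧
        (axisSteps w : ℤ) = k - (if (s = QStep.E ∨ s = QStep.W) ∧ j - dys s = 0 then 1 else 0) ∧
        (s = QStep.NW2 → j - dys s = 0))} := by
    intro s
    ext w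
    exact and_congr_right (key s w)
  simp only [key2]
  by_cases hj1 : j = 1
  · subst hj1
    simp [dxs, dys]
  · have : ¬ (j - 1 = 0) := by omega
    simp [dxs, dys, hj1, this]

/-- exponent vector -/
noncomputable def ev (i j k n : ℤ) : Fin 4 →₀ ℕ :=
  Finsupp.equivFunOnFinite.symm ![i.toNat, j.toNat, k.toNat, n.toNat]

/-- coefficient with integer exponents -/
noncomputable def cz (φ : MvPowerSeries (Fin 4) ℤ) (i j k n : ℤ) : ℤ :=
  if 0 ≤ i ∧ 0 ≤ j ∧ 0 ≤ k ∧ 0 ≤ n then φ (ev i j k n) else 0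

theorem coeff_X_mul' (s : Fin 4) (φ : MvPowerSeries (Fin 4) ℤ) (d : Fin 4 →₀ ℕ) :
    (MvPowerSeries.X s * φ : MvPowerSeries (Fin 4) ℤ) d = if 1 ≤ d s then φ (d - Finsupp.single s 1) else 0 := by
  have := MvPowerSeries.coeff_monomial_mul d (Finsupp.single s 1) φ (1 : ℤ)
  simp only [Finsupp.single_le_iff, one_mul] at this
  exact this

theorem cz_X (s : Fin 4) (φ : MvPowerSeries (Fin 4) ℤ) (i j k n : ℤ) :
    cz (MvPowerSeries.X s * φ) i j k n =
      cz φ (i - if s = 0 then 1 else 0) (j - if s = 1 then 1 else 0)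
        (k - if s = 2 then 1 else 0) (n - if s = 3 then 1 else 0) := by
  unfold cz
  rw [coeff_X_mul']
  have hd : ev i j k n - Finsupp.single s 1 =
      ev (i - if s = 0 then 1 else 0) (j - if s = 1 then 1 else 0)
        (k - if s = 2 then 1 else 0) (n - if s = 3 then 1 else 0) := by
    ext t
    fin_cases s <;> fin_cases t <;> simp [ev] <;> omega
  rw [hd]
  have h1 : 1 ≤ ev i j k n s ↔ 1 ≤ ![i, j, k, n] s := by
    fin_cases s <;> simp [ev] <;> omega
  simp only [h1]
  clear h1 hd
  fin_cases s <;> simp <;> split_ifs <;> first | rfl | omega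

theorem cz_X0 (φ : MvPowerSeries (Fin 4) ℤ) (i j k n : ℤ) :
    cz (MvPowerSeries.X 0 * φ) i j k n = cz φ (i - 1) j k n := by simp [cz_X]
theorem cz_X1 (φ : MvPowerSeries (Fin 4) ℤ) (i j k n : ℤ) :
    cz (MvPowerSeries.X 1 * φ) i j k n = cz φ i (j - 1) k n := by simp [cz_X]
theorem cz_X2 (φ : MvPowerSeries (Fin 4) ℤ) (i j k n : ℤ) :
    cz (MvPowerSeries.X 2 * φ) i j k n = cz φ i j (k - 1) n := by simp [cz_X]
theorem cz_X3 (φ : MvPowerSeries (Fin 4) ℤ) (i j k n : ℤ) :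
    cz (MvPowerSeries.X 3 * φ) i j k n = cz φ i j k (n - 1) := by simp [cz_X]
theorem cz_add (φ ψ : MvPowerSeries (Fin 4) ℤ) (i j k n : ℤ) :
    cz (φ + ψ) i j k n = cz φ i j k n + cz ψ i j k n := by
  unfold cz
  split_ifs
  · rfl
  · rfl
theorem cz_sub (φ ψ : MvPowerSeries (Fin 4) ℤ) (i j k n : ℤ) :
    cz (φ - ψ) i j k n = cz φ i j k n - cz ψ i j k n := by
  unfold cz
  split_ifs
  · rfl
  · rfl
theorem cz_one (i j k n : ℤ) :
    cz 1 i j k n = if i = 0 ∧ j = 0 ∧ k = 0 ∧ n = 0 then 1 else 0 := by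
  classical
  unfold cz
  have h := MvPowerSeries.coeff_one (R := ℤ) (ev i j k n)
  change (1 : MvPowerSeries (Fin 4) ℤ) (ev i j k n) = _ at h
  rw [h]
  have : ev i j k n = 0 ↔ i ≤ 0 ∧ j ≤ 0 ∧ k ≤ 0 ∧ n ≤ 0 := by
    rw [DFunLike.ext_iff, Fin.forall_fin_succ, Fin.forall_fin_succ, Fin.forall_fin_succ,
      Fin.forall_fin_one]
    simp [ev]
  simp only [this]
  split_ifs <;> first | rfl | omega

theorem cz_ext (φ ψ : MvPowerSeries (Fin 4) ℤ)
    (h : ∀ (i j k : ℤ) (n : ℕ), 0 ≤ i → 0 ≤ j → 0 ≤ k → cz φ i j k n = cz ψ i j k n) : φ = ψ := by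
  funext d
  have := h (d 0) (d 1) (d 2) (d 3) (by omega) (by omega) (by omega)
  have hd : ev (d 0) (d 1) (d 2) (d 3) = d := by
    ext t
    fin_cases t <;> simp [ev]
  simpa [cz, hd] using this

/-- integer-indexed coefficient of `R` -/
noncomputable def rr (i j k n : ℤ) : ℤ := if 0 ≤ n then rz i j k n.toNat else 0

theorem rr_neg (i j k n : ℤ) (h : i < 0 ∨ j < 0 ∨ k < 0 ∨ n < 0) : rr i j k n = 0 := by
  unfold rr
  split_ifs with hn
  · rw [rz_neg _ _ _ _ (by omega)]; rfl
  · rfl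

theorem ev0 (i j k n : ℤ) : ev i j k n 0 = i.toNat := by simp [ev]
theorem ev1 (i j k n : ℤ) : ev i j k n 1 = j.toNat := by simp [ev]
theorem ev2 (i j k n : ℤ) : ev i j k n 2 = k.toNat := by simp [ev]
theorem ev3 (i j k n : ℤ) : ev i j k n 3 = n.toNat := by simp [ev]

theorem cz_R (i j k n : ℤ) : cz R i j k n = rr i j k n := by
  by_cases h : 0 ≤ i ∧ 0 ≤ j ∧ 0 ≤ k ∧ 0 ≤ n
  · obtain ⟨h0, h1, h2, h3⟩ := h
    simp [cz, rr, R, ev0, ev1, ev2, ev3, r_eq_rz, h0, h1, h2, h3]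
  · rw [rr_neg _ _ _ _ (by omega), cz, if_neg h]
theorem cz_Ry (i j k n : ℤ) : cz Ry i j k n = if i = 0 then rr i j k n else 0 := by
  by_cases h : 0 ≤ i ∧ 0 ≤ j ∧ 0 ≤ k ∧ 0 ≤ n
  · obtain ⟨h0, h1, h2, h3⟩ := h
    have : i ≤ 0 ↔ i = 0 := by omega
    simp only [cz, rr, Ry, ev0, ev1, ev2, ev3, r_eq_rz, h0, h1, h2, h3]
    simp [this, h1, h2]
    split_ifs with h
    · simp [h]
    · rfl
  · rw [rr_neg _ _ _ _ (by omega), cz, if_neg h]; simp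
theorem cz_Rx (i j k n : ℤ) : cz Rx i j k n = if j = 0 then rr i j k n else 0 := by
  by_cases h : 0 ≤ i ∧ 0 ≤ j ∧ 0 ≤ k ∧ 0 ≤ n
  · obtain ⟨h0, h1, h2, h3⟩ := h
    have : j ≤ 0 ↔ j = 0 := by omega
    simp only [cz, rr, Rx, ev0, ev1, ev2, ev3, r_eq_rz, h0, h1, h2, h3]
    simp [this, h0, h2]
    split_ifs with h
    · simp [h]
    · rfl
  · rw [rr_neg _ _ _ _ (by omega), cz, if_neg h]; simp
theorem cz_R0 (i j k n : ℤ) : cz R0 i j k n = if i = 0 ∧ j = 0 then rr i j k n else 0 := by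
  by_cases h : 0 ≤ i ∧ 0 ≤ j ∧ 0 ≤ k ∧ 0 ≤ n
  · obtain ⟨h0, h1, h2, h3⟩ := h
    have : j ≤ 0 ↔ j = 0 := by omega
    have : i ≤ 0 ↔ i = 0 := by omega
    simp only [cz, rr, R0, ev0, ev1, ev2, ev3, r_eq_rz, h0, h1, h2, h3]
    simp [*]
    split_ifs with h
    · simp [h]
    · rfl
  · rw [rr_neg _ _ _ _ (by omega), cz, if_neg h]; simp

theorem rr_zero (i j k : ℤ) : rr i j k 0 = if i = 0 ∧ j = 0 ∧ k = 0 then 1 else 0 := by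
  simp [rr, rz_zero]

theorem rr_succ (i j k : ℤ) (n : ℕ) (hi : 0 ≤ i) (hj : 0 ≤ j) :
    rr i j k (n + 1) =
      rr (i - 1) j (k - if j = 0 then 1 else 0) n + rr (i + 1) j (k - if j = 0 then 1 else 0) n
      + rr (i + 1) (j - 1) k n + (if j = 1 then rr (i + 1) (j - 1) k n else 0)
      + rr (i - 1) (j + 1) k n := by
  have h1 : (0 : ℤ) ≤ n := by omega
  have h2 : (0 : ℤ) ≤ n + 1 := by omega
  have h3 : ((n : ℤ) + 1).toNat = n + 1 := by omega
  simp only [rr, h1, h2, h3, if_true, Int.toNat_natCast, rz_succ i j k n hi hj]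
  push_cast
  rfl

theorem func_eq :
    (MvPowerSeries.X 0 * MvPowerSeries.X 1
        - MvPowerSeries.X 3 * (MvPowerSeries.X 1 + (MvPowerSeries.X 0) ^ 2)
          * (1 + MvPowerSeries.X 1)) * R
      = MvPowerSeries.X 0 * MvPowerSeries.X 1
        - MvPowerSeries.X 3 * MvPowerSeries.X 1 * (1 + MvPowerSeries.X 1) * Ry
        + MvPowerSeries.X 3 * ((MvPowerSeries.X 1) ^ 2 - (MvPowerSeries.X 0) ^ 2
            + (MvPowerSeries.X 2 - 1) * MvPowerSeries.X 1 * ((MvPowerSeries.X 0) ^ 2 + 1)) * Rx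
        - MvPowerSeries.X 3 * MvPowerSeries.X 1
            * (MvPowerSeries.X 1 + MvPowerSeries.X 2 - 1) * R0 := by
  apply cz_ext
  intro i j k n hi hj hk
  have hX : (MvPowerSeries.X 0 * MvPowerSeries.X 1 : MvPowerSeries (Fin 4) ℤ)
      = MvPowerSeries.X 0 * (MvPowerSeries.X 1 * 1) := by rw [mul_one]
  rw [sub_mul _ _ R]
  nth_rewrite 2 [hX]
  simp only [mul_add, add_mul, sub_mul, mul_sub, pow_two, mul_assoc, one_mul]
  simp only [cz_add, cz_sub, cz_X0, cz_X1, cz_X2, cz_X3, cz_R, cz_Rx, cz_Ry, cz_R0, cz_one]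
  rcases n with _ | n
  · have e (i j k : ℤ) : rr i j k (-1) = 0 := rr_neg _ _ _ _ (by omega)
    simp only [Nat.cast_zero, zero_sub, e, rr_zero]
    simp [sub_eq_zero]
  · have e : ((n + 1 : ℕ) : ℤ) - 1 = n := by push_cast; ring
    have e2 : ((n + 1 : ℕ) : ℤ) = n + 1 := by push_cast; ring
    rw [e, e2]
    have e3 : ¬ ((n : ℤ) + 1 = 0) := by omega
    simp only [e3, and_false, if_false]
    generalize hN : (n : ℤ) = N
    have hneg1 : ∀ j k, rr (-1) j k N = 0 := fun _ _ => rr_neg _ _ _ _ (by omega)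
    have hneg2 : ∀ j k, rr (-2) j k N = 0 := fun _ _ => rr_neg _ _ _ _ (by omega)
    have hneg1' : ∀ i k, rr i (-1) k N = 0 := fun _ _ => rr_neg _ _ _ _ (by omega)
    have hneg2' : ∀ i k, rr i (-2) k N = 0 := fun _ _ => rr_neg _ _ _ _ (by omega)
    have hM : ∀ i j k, i < 0 ∨ j < 0 → rr i j k (N + 1) = 0 :=
      fun _ _ _ _ => rr_neg _ _ _ _ (by omega)
    rcases hi.lt_or_eq with hi | rfl
    · rcases hj.lt_or_eq with hj | rfl
      · have := rr_succ (i - 1) (j - 1) k n (by omega) (by omega)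
        rw [hN] at this
        rw [this]
        have hi0 : i ≠ 0 := by omega
        have hj0 : j ≠ 0 := by omega
        by_cases hj1 : j = 1
        · subst hj1
          simp [hi0, hneg1']
          ring
        · have hj1' : j - 1 ≠ 0 := by omega
          by_cases hj2 : j = 2
          · subst hj2
            simp [hi0]
            ring
          · have hj2' : j - 1 - 1 ≠ 0 := by omega
            have hj3' : j - 1 ≠ 1 := by omega
            simp [hi0, hj0, hj1', hj2', hj3']
            ring
      · simp [hneg1', hneg2', hM]
    · rw [hM _ _ _ (by omega)]
      by_cases hj1 : j = 1
      · subst hj1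
        simp [hneg1', hneg2]
      · have hj1' : j - 1 ≠ 0 := by omega
        by_cases hj2 : j = 2
        · subst hj2
          simp [hneg2]
          ring
        · have hj2' : j - 1 - 1 ≠ 0 := by omega
          simp [hj1', hj2', hneg2]

/-- Height of the first path of a pair. -/
def hA (p : List (Bool × Bool)) (j : ℕ) : ℤ := ht (p.map Prod.fst) j
/-- Height of the second path of a pair. -/
def hB (p : List (Bool × Bool)) (j : ℕ) : ℤ := ht (p.map Prod.snd) j
def POK (p : List (Bool × Bool)) : Prop := ∀ j, 0 ≤ hA p j ∧ 0 ≤ hB p j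
def symm' (p : List (Bool × Bool)) : ℕ :=
  ((Finset.range p.length).filter fun i => hA p i = hB p i ∧ hA p (i + 1) = hB p (i + 1)).card

def sg (b : Bool) : ℤ := if b then 1 else -1

theorem ht_snoc_le (w : List Bool) (s) (j : ℕ) (h : j ≤ w.length) :
    ht (w ++ [s]) j = ht w j := by
  simp [ht, List.take_append_of_le_length h]
theorem ht_snoc_gt (w : List Bool) (s) (j : ℕ) (h : w.length < j) :
    ht (w ++ [s]) j = ht w w.length + sg s := by
  unfold ht
  rw [List.take_of_length_le (by simp; omega), List.take_of_length_le le_rfl]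
  cases s <;> simp [List.count_append, sg] <;> ring
theorem ht_ge (w : List Bool) (j : ℕ) (h : w.length ≤ j) : ht w j = ht w w.length := by
  unfold ht
  rw [List.take_of_length_le h, List.take_of_length_le le_rfl]

theorem hA_snoc_le (p) (s) (j : ℕ) (h : j ≤ p.length) : hA (p ++ [s]) j = hA p j := by
  simp only [hA, List.map_append, List.map_singleton]
  exact ht_snoc_le _ _ _ (by simpa using h)
theorem hB_snoc_le (p) (s) (j : ℕ) (h : j ≤ p.length) : hB (p ++ [s]) j = hB p j := by
  simp only [hB, List.map_append, List.map_singleton]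
  exact ht_snoc_le _ _ _ (by simpa using h)
theorem hA_snoc_gt (p) (s) (j : ℕ) (h : p.length < j) :
    hA (p ++ [s]) j = hA p p.length + sg s.1 := by
  simp only [hA, List.map_append, List.map_singleton]
  rw [ht_snoc_gt _ _ _ (by simpa using h), List.length_map]
theorem hB_snoc_gt (p) (s) (j : ℕ) (h : p.length < j) :
    hB (p ++ [s]) j = hB p p.length + sg s.2 := by
  simp only [hB, List.map_append, List.map_singleton]
  rw [ht_snoc_gt _ _ _ (by simpa using h), List.length_map]
theorem hA_ge (p) (j : ℕ) (h : p.length ≤ j) : hA p j = hA p p.length := by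
  unfold hA
  rw [ht_ge _ _ (by simpa using h), List.length_map]
theorem hB_ge (p) (j : ℕ) (h : p.length ≤ j) : hB p j = hB p p.length := by
  unfold hB
  rw [ht_ge _ _ (by simpa using h), List.length_map]

theorem POK_snoc (p) (s) : POK (p ++ [s]) ↔ POK p ∧ 0 ≤ hA p p.length + sg s.1 ∧
    0 ≤ hB p p.length + sg s.2 := by
  unfold POK
  constructor
  · intro h1
    refine ⟨fun j => ?_, ?_, ?_⟩
    · rcases le_total j p.length with h | h
      · have := h1 j
        rwa [hA_snoc_le _ _ _ h, hB_snoc_le _ _ _ h] at this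
      · have := h1 p.length
        rwa [hA_snoc_le _ _ _ le_rfl, hB_snoc_le _ _ _ le_rfl, ← hA_ge p j h,
          ← hB_ge p j h] at this
    · have := (h1 (p.length + 1)).1
      rwa [hA_snoc_gt _ _ _ (by omega)] at this
    · have := (h1 (p.length + 1)).2
      rwa [hB_snoc_gt _ _ _ (by omega)] at this
  · rintro ⟨h1, hx, hy⟩ j
    rcases le_or_gt j p.length with h | h
    · rw [hA_snoc_le _ _ _ h, hB_snoc_le _ _ _ h]
      exact h1 j
    · rw [hA_snoc_gt _ _ _ h, hB_snoc_gt _ _ _ h]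
      exact ⟨hx, hy⟩

theorem symm_snoc (p) (s) : symm' (p ++ [s]) = symm' p +
    if hA p p.length = hB p p.length ∧ hA p p.length + sg s.1 = hB p p.length + sg s.2
      then 1 else 0 := by
  unfold symm'
  rw [List.length_append, List.length_singleton, Finset.range_add_one, Finset.filter_insert]
  have hc : ((Finset.range p.length).filter fun i => hA (p ++ [s]) i = hB (p ++ [s]) i ∧
        hA (p ++ [s]) (i + 1) = hB (p ++ [s]) (i + 1)) =
      ((Finset.range p.length).filter fun i => hA p i = hB p i ∧ hA p (i + 1) = hB p (i + 1)) := by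
    refine Finset.filter_congr fun i hi => ?_
    have hi := Finset.mem_range.1 hi
    rw [hA_snoc_le _ _ _ hi.le, hB_snoc_le _ _ _ hi.le, hA_snoc_le _ _ (i + 1) hi,
      hB_snoc_le _ _ (i + 1) hi]
  rw [hc, hA_snoc_le _ _ _ le_rfl, hB_snoc_le _ _ _ le_rfl, hA_snoc_gt _ _ _ (by omega),
    hB_snoc_gt _ _ _ (by omega)]
  split_ifs with h
  · rw [Finset.card_insert_of_notMem (by simp)]
  · rfl

/-- Number of pairs of nonnegative paths of length `n` with prescribed end heights. -/
noncomputable def fp (a b k : ℤ) (n : ℕ) : ℕ :=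
  {p : List (Bool × Bool) | p.length = n ∧ (POK p ∧
    hA p n = a ∧ hB p n = b ∧ (symm' p : ℤ) = k)}.ncard

theorem fp_neg (a b k : ℤ) (n : ℕ) (h : a < 0 ∨ b < 0) : fp a b k n = 0 := by
  unfold fp
  convert Set.ncard_empty (List (Bool × Bool))
  ext w
  simp only [Set.mem_ofPred_eq, Set.mem_empty_iff_false, iff_false]
  rintro ⟨-, hw, h1, h2, h3⟩
  have := hw n
  omega

theorem fp_zero (i j k : ℤ) : fp i j k 0 = if i = 0 ∧ j = 0 ∧ k = 0 then 1 else 0 := by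
  unfold fp
  have h0 : POK [] := fun j => by simp [hA, hB, ht]
  split_ifs with h
  · obtain ⟨rfl, rfl, rfl⟩ := h
    rw [Set.ncard_eq_one]
    refine ⟨[], ?_⟩
    ext w
    simp only [Set.mem_ofPred_eq, List.length_eq_zero_iff, Set.mem_singleton_iff]
    constructor
    · exact fun h => h.1
    · rintro rfl
      exact ⟨rfl, h0, by simp [hA, ht], by simp [hB, ht], by simp [symm']⟩
  · convert Set.ncard_empty (List (Bool × Bool))
    ext w
    simp only [Set.mem_ofPred_eq, Set.mem_empty_iff_false, iff_false, List.length_eq_zero_iff]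
    rintro ⟨rfl, hw, h1, h2, h3⟩
    simp [hA, hB, ht, symm'] at h1 h2 h3
    omega

theorem fp_succ (a b k : ℤ) (n : ℕ) (ha : 0 ≤ a) (hb : 0 ≤ b) :
    fp a b k (n + 1) =
      fp (a - 1) (b - 1) (k - if a = b then 1 else 0) n
      + fp (a + 1) (b + 1) (k - if a = b then 1 else 0) n
      + fp (a - 1) (b + 1) k n + fp (a + 1) (b - 1) k n := by
  unfold fp
  rw [ncard_snoc, Fintype.sum_prod_type]
  simp only [Fintype.sum_bool]
  have key : ∀ s : Bool × Bool, ∀ w : List (Bool × Bool), w.length = n →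
      ((POK (w ++ [s]) ∧ hA (w ++ [s]) (n + 1) = a ∧ hB (w ++ [s]) (n + 1) = b ∧
        (symm' (w ++ [s]) : ℤ) = k) ↔
      (POK w ∧ hA w n = a - sg s.1 ∧ hB w n = b - sg s.2 ∧
        (symm' w : ℤ) = k - (if a - sg s.1 = b - sg s.2 ∧ a = b then 1 else 0))) := by
    intro s w hw
    subst hw
    rw [POK_snoc, symm_snoc, hA_snoc_gt _ _ _ (by omega), hB_snoc_gt _ _ _ (by omega)]
    constructor
    · rintro ⟨⟨h1, h2, h3⟩, h5, h6, h7⟩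
      have e : hA w w.length = a - sg s.1 := by omega
      have e' : hB w w.length = b - sg s.2 := by omega
      rw [e, e'] at h7
      simp only [sub_add_cancel] at h7
      refine ⟨h1, e, e', ?_⟩
      push_cast at h7
      omega
    · rintro ⟨h1, h5, h6, h7⟩
      rw [h6, h5]
      simp only [sub_add_cancel]
      refine ⟨⟨h1, ha, hb⟩, trivial, trivial, ?_⟩
      push_cast
      omega
  have key2 : ∀ s : Bool × Bool, {w : List (Bool × Bool) | w.length = n ∧ (POK (w ++ [s]) ∧
        hA (w ++ [s]) (n + 1) = a ∧ hB (w ++ [s]) (n + 1) = b ∧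
        (symm' (w ++ [s]) : ℤ) = k)} = {w : List (Bool × Bool) | w.length = n ∧
      (POK w ∧ hA w n = a - sg s.1 ∧ hB w n = b - sg s.2 ∧
        (symm' w : ℤ) = k - (if a - sg s.1 = b - sg s.2 ∧ a = b then 1 else 0))} := by
    intro s
    ext w
    exact and_congr_right (key s w)
  simp only [key2]
  have h1 : ¬ (a - 1 = b + 1 ∧ a = b) := by omega
  have h2 : ¬ (a + 1 = b - 1 ∧ a = b) := by omega
  simp [sg, h1, h2]
  ring

theorem rz_eq_fp (n : ℕ) : ∀ i k : ℤ, rz i 0 k n = fp i i k n ∧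
    ∀ j : ℤ, 0 < j → rz i j k n = fp i (i + 2 * j) k n + fp (i + 2 * j) i k n := by
  induction n with
  | zero =>
    intro i k
    simp only [rz_zero, fp_zero]
    refine ⟨by simp, fun j hj => ?_⟩
    rw [if_neg (by omega), if_neg (by omega), if_neg (by omega)]
  | succ n ih =>
    intro i k
    rcases lt_or_ge i 0 with hi | hi
    · refine ⟨?_, fun j hj => ?_⟩
      · rw [rz_neg _ _ _ _ (by omega), fp_neg _ _ _ _ (by omega)]
      · rw [rz_neg _ _ _ _ (by omega), fp_neg _ _ _ _ (by omega), fp_neg _ _ _ _ (by omega)]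
    refine ⟨?_, fun j hj => ?_⟩
    · rw [rz_succ _ _ _ _ hi le_rfl, fp_succ _ _ _ _ hi hi]
      have h1 := (ih (i - 1) k).2 1 (by omega)
      rw [show i - 1 + 2 * 1 = i + 1 by ring] at h1
      rw [rz_neg (i + 1) (0 - 1) _ _ (by omega)]
      simp [(ih _ _).1, h1]
      ring
    · rw [rz_succ _ _ _ _ hi hj.le, fp_succ _ _ _ _ hi (by omega), fp_succ _ _ _ _ (by omega) hi,
        if_neg (c := j = 0) (by omega), if_neg (c := i = i + 2 * j) (by omega),
        if_neg (c := i + 2 * j = i) (by omega)]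
      simp only [sub_zero]
      rw [(ih (i - 1) _).2 j hj, (ih (i + 1) _).2 j hj, (ih (i - 1) _).2 (j + 1) (by omega),
        show i - 1 + 2 * j = i + 2 * j - 1 by ring, show i + 1 + 2 * j = i + 2 * j + 1 by ring,
        show i - 1 + 2 * (j + 1) = i + 2 * j + 1 by ring]
      by_cases hj1 : j = 1
      · subst hj1
        rw [if_pos rfl, show (1 : ℤ) - 1 = 0 by ring, (ih _ _).1,
          show i + 2 * 1 - 1 = i + 1 by ring]
        ring
      · rw [if_neg hj1, (ih _ _).2 (j - 1) (by omega),
          show i + 1 + 2 * (j - 1) = i + 2 * j - 1 by ring]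
        ring

/-- Unfold a pair into a word of length `2n`. -/
def unf (p : List (Bool × Bool)) : List Bool :=
  p.map Prod.fst ++ ((p.map Prod.snd).map not).reverse

theorem count_not (l : List Bool) (b : Bool) : (l.map not).count b = l.count (!b) := by
  induction l with
  | nil => rfl
  | cons a l ih => cases a <;> cases b <;> simp [ih]

theorem unf_length (p) : (unf p).length = 2 * p.length := by
  simp [unf]; ring

theorem ht_unf_le (p) (j : ℕ) (h : j ≤ p.length) : ht (unf p) j = hA p j := by
  unfold ht hA ht unf
  rw [List.take_append_of_le_length (by simpa using h)]

theorem ht_unf_ge (p) (j : ℕ) (h : j ≤ p.length) :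
    ht (unf p) (2 * p.length - j) = hA p p.length - hB p p.length + hB p j := by
  have hl : (p.map Prod.fst).length = p.length := by simp
  have hl2 : ((p.map Prod.snd).map not).length = p.length := by simp
  unfold ht hA hB ht unf
  rw [List.take_append, hl, List.take_of_length_le (l := p.map Prod.fst) (by rw [hl]; omega),
    List.take_of_length_le (l := p.map Prod.fst) (by rw [hl]),
    List.take_of_length_le (l := p.map Prod.snd) (by simp), List.take_reverse, hl2,
    show p.length - (2 * p.length - j - p.length) = j by omega]
  generalize p.map Prod.snd = B
  have hT := congrArg (List.count true) (List.take_append_drop j B)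
  have hF := congrArg (List.count false) (List.take_append_drop j B)
  rw [List.count_append] at hT hF
  rw [List.count_append, List.count_append, List.count_reverse, List.count_reverse,
    ← List.map_drop, count_not, count_not]
  simp only [Bool.not_true, Bool.not_false]
  push_cast
  omega

theorem unf_inj (p q) (h : p.length = q.length) (e : unf p = unf q) : p = q := by
  unfold unf at e
  obtain ⟨h1, h2⟩ := List.append_inj e (by simpa using h)
  rw [List.reverse_inj] at h2
  have h3 := List.map_injective_iff.2 (fun a b => by cases a <;> cases b <;> simp) h2
  have z1 := List.zip_unzip p
  have z2 := List.zip_unzip q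
  rw [List.unzip_eq_map] at z1 z2
  rw [← z1, ← z2, h1, h3]

theorem unf_surj (n : ℕ) (w : List Bool) (h : w.length = 2 * n) : ∃ p, p.length = n ∧ unf p = w := by
  refine ⟨(w.take n).zip (((w.drop n).map not).reverse), ?_, ?_⟩
  · simp; omega
  · unfold unf
    rw [List.map_fst_zip (by simp; omega), List.map_snd_zip (by simp; omega)]
    simp [Function.comp_def]

theorem count_bool (l : List Bool) : l.count true + l.count false = l.length := by
  induction l with
  | nil => rfl
  | cons a l ih => cases a <;> simp <;> omega

theorem isDyck_unf (n : ℕ) (p) (h : p.length = n) :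
    IsDyck n (unf p) ↔ POK p ∧ hA p n = hB p n := by
  subst h
  have h0 := ht_unf_ge p 0 (by omega)
  have hB0 : hB p 0 = 0 := by simp [hB, ht]
  have hc := count_bool (unf p)
  rw [unf_length] at hc
  have hfull : ht (unf p) (2 * p.length) = (unf p).count true - (unf p).count false := by
    unfold ht
    rw [List.take_of_length_le (by rw [unf_length])]
  rw [Nat.sub_zero, hfull, hB0] at h0
  unfold IsDyck
  rw [unf_length]
  constructor
  · rintro ⟨-, h1, h2⟩
    have e : hA p p.length = hB p p.length := by omega
    refine ⟨fun j => ?_, e⟩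
    rcases le_total j p.length with h | h
    · have a1 := h2 j
      have a2 := h2 (2 * p.length - j)
      rw [ht_unf_le _ _ h] at a1
      rw [ht_unf_ge _ _ h] at a2
      omega
    · rw [hA_ge _ _ h, hB_ge _ _ h]
      have a1 := h2 p.length
      rw [ht_unf_le _ _ le_rfl] at a1
      omega
  · rintro ⟨h1, e⟩
    refine ⟨rfl, by omega, fun j => ?_⟩
    rcases le_total j p.length with h | h
    · rw [ht_unf_le _ _ h]
      exact (h1 j).1
    · rcases le_total j (2 * p.length) with h' | h'
      · obtain ⟨i, hi, rfl⟩ : ∃ i, i ≤ p.length ∧ j = 2 * p.length - i :=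
          ⟨2 * p.length - j, by omega, by omega⟩
        rw [ht_unf_ge _ _ hi]
        have := (h1 i).2
        omega
      · rw [ht_ge _ _ (by rw [unf_length]; exact h'), unf_length, hfull]
        omega

theorem ds_unf (n : ℕ) (p) (h : p.length = n) (e : hA p n = hB p n) :
    dsGD n (unf p) = symm' p := by
  subst h
  unfold dsGD symm'
  symm
  refine Finset.card_bij (fun i _ => i + 1) ?_ ?_ ?_
  · intro i hi
    simp only [Finset.mem_filter, Finset.mem_range, Finset.mem_Icc] at hi ⊢
    obtain ⟨hi, h1, h2⟩ := hi
    refine ⟨by omega, ?_, ?_⟩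
    · rw [Nat.add_sub_cancel, show 2 * p.length + 1 - (i + 1) = 2 * p.length - i by omega,
        ht_unf_le _ _ hi.le, ht_unf_ge _ _ hi.le]
      omega
    · rw [ht_unf_le _ _ (by omega), ht_unf_ge _ _ (by omega)]
      omega
  · intro a _ b _ h
    omega
  · intro i hi
    simp only [Finset.mem_filter, Finset.mem_range, Finset.mem_Icc] at hi ⊢
    obtain ⟨⟨hi0, hi⟩, h1, h2⟩ := hi
    obtain ⟨m, rfl⟩ : ∃ m, i = m + 1 := ⟨i - 1, by omega⟩
    rw [Nat.add_sub_cancel, show 2 * p.length + 1 - (m + 1) = 2 * p.length - m by omega,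
        ht_unf_le _ _ (by omega), ht_unf_ge _ _ (by omega)] at h1
    rw [ht_unf_le _ _ (by omega), ht_unf_ge _ _ (by omega)] at h2
    exact ⟨m, ⟨by omega, by omega, by omega⟩, rfl⟩

theorem dyck_count (n k : ℕ) :
    {w : List Bool | IsDyck n w ∧ dsGD n w = k}.ncard = ∑ᶠ i, r i 0 k n := by
  have h1 : {w : List Bool | IsDyck n w ∧ dsGD n w = k}
      = unf '' {p | p.length = n ∧ (POK p ∧ hA p n = hB p n ∧ symm' p = k)} := by
    ext w
    simp only [Set.mem_ofPred_eq, Set.mem_image]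
    constructor
    · rintro ⟨hw, hk⟩
      obtain ⟨p, hp, rfl⟩ := unf_surj n w hw.1
      obtain ⟨h2, h3⟩ := (isDyck_unf n p hp).1 hw
      exact ⟨p, ⟨hp, h2, h3, by rw [← ds_unf n p hp h3]; exact hk⟩, rfl⟩
    · rintro ⟨p, ⟨hp, h2, h3, h4⟩, rfl⟩
      exact ⟨(isDyck_unf n p hp).2 ⟨h2, h3⟩, by rw [ds_unf n p hp h3]; exact h4⟩
  rw [h1, Set.ncard_image_of_injOn
    (fun p hp q hq e => unf_inj p q (hp.1.trans hq.1.symm) e)]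
  have h2 : {p : List (Bool × Bool) | p.length = n ∧ (POK p ∧ hA p n = hB p n ∧ symm' p = k)}
      = ⋃ i ∈ (Finset.range (n + 1) : Set ℕ), {p | p.length = n ∧ (POK p ∧
    hA p n = (i : ℤ) ∧ hB p n = (i : ℤ) ∧ (symm' p : ℤ) = (k : ℤ))} := by
    ext p
    simp only [Set.mem_ofPred_eq, Set.mem_iUnion, Finset.coe_range, Set.mem_Iio, exists_prop]
    constructor
    · rintro ⟨hp, h1, h2, h3⟩
      have hub : hA p n ≤ n := by
        unfold hA ht
        have := List.count_le_length (a := true) (l := (p.map Prod.fst).take n)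
        have h5 : ((p.map Prod.fst).take n).length = n := by simp [hp]
        omega
      have := (h1 n).1
      exact ⟨(hA p n).toNat, by omega, hp, h1, by omega, by omega, by omega⟩
    · rintro ⟨i, hi, hp, h1, h2, h3, h4⟩
      exact ⟨hp, h1, by omega, by omega⟩
  have hz : ∀ i, r i 0 k n = fp i i k n := fun i => by
    rw [r_eq_rz]
    exact (rz_eq_fp n i k).1
  have hfin : ∀ i : ℕ, {p : List (Bool × Bool) | p.length = n ∧ (POK p ∧
    hA p n = (i : ℤ) ∧ hB p n = (i : ℤ) ∧ (symm' p : ℤ) = (k : ℤ))}.Finite := fun i =>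
    (List.finite_length_eq _ n).subset fun w hw => hw.1
  rw [h2, Set.Finite.ncard_biUnion (Finset.finite_toSet _) (fun i _ => hfin i)]
  · simp only [hz]
    rw [finsum_mem_inter_support_eq _ _ Set.univ, finsum_mem_univ]
    · rfl
    ext i
    simp only [Set.mem_inter_iff, Set.mem_univ, true_and, Function.mem_support, and_iff_right_iff_imp]
    intro hne
    obtain ⟨p, hp, -, h3, -⟩ := Set.nonempty_of_ncard_ne_zero hne
    have hub : hA p n ≤ n := by
      unfold hA ht
      have := List.count_le_length (a := true) (l := (p.map Prod.fst).take n)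
      have h5 : ((p.map Prod.fst).take n).length = n := by simp [hp]
      omega
    simp
    omega
  · intro i _ j _ hij
    rw [Function.onFun, Set.disjoint_left]
    rintro p ⟨_, _, h1, _⟩ ⟨_, _, h2, _⟩
    omega

/-- (1) The functional equation
`(xy − z(y+x²)(1+y))·R = xy − zy(1+y)·R^y + z(y² − x² + (s−1)y(x²+1))·R^x − zy(y+s−1)·R^0`
holds in `ℤ[[x,y,s,z]]`; and (2) the number of Dyck paths of semilength `n` with degree of
symmetry `k` equals `Σ_i r(i,0,k,n)`. -/
theorem dyck_ds_functional_equation :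
    (MvPowerSeries.X 0 * MvPowerSeries.X 1
        - MvPowerSeries.X 3 * (MvPowerSeries.X 1 + (MvPowerSeries.X 0) ^ 2)
          * (1 + MvPowerSeries.X 1)) * R
      = MvPowerSeries.X 0 * MvPowerSeries.X 1
        - MvPowerSeries.X 3 * MvPowerSeries.X 1 * (1 + MvPowerSeries.X 1) * Ry
        + MvPowerSeries.X 3 * ((MvPowerSeries.X 1) ^ 2 - (MvPowerSeries.X 0) ^ 2
            + (MvPowerSeries.X 2 - 1) * MvPowerSeries.X 1 * ((MvPowerSeries.X 0) ^ 2 + 1)) * Rx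
        - MvPowerSeries.X 3 * MvPowerSeries.X 1
            * (MvPowerSeries.X 1 + MvPowerSeries.X 2 - 1) * R0 ∧
    ∀ n k : ℕ,
      {w : List Bool | IsDyck n w ∧ dsGD n w = k}.ncard = ∑ᶠ i, r i 0 k n := by
  exact ⟨func_eq, dyck_count⟩
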